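/- Let K be a compact convex domain in ℝ³ and ζ a signed measure supported on ∂K with ζ(∂K) = 0. Then the minimum of the total mass |α|(K) over all measure-valued 2-forms α supported in K satisfying dα = 0 in the interior of K and α_⊤ = ζ on ∂K is at most C‖ζ‖_{W^{-1,1}(ℝ³)}, where ‖ζ‖_{W^{-1,1}(ℝ³)} = sup{ ∫φ dζ : φ ∈ W^{1,∞}_c(ℝ³), ‖φ‖_{W^{1,∞}(ℝ³)} ≤ 1 } and C may depend on K. -/

import Mathlib

open Set Metric MeasureTheory

noncomputable section

abbrev E3 : Type := EuclideanSpace ℝ (Fin 3)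

def mk3 (f : Fin 3 → ℝ) : E3 := (WithLp.equiv 2 (Fin 3 → ℝ)).symm f
def e3 (i : Fin 3) : E3 := EuclideanSpace.single i 1
def dot3 (x y : E3) : ℝ := ∑ i, x i * y i
def pd3 (f : E3 → ℝ) (i : Fin 3) (x : E3) : ℝ := fderiv ℝ f x (e3 i)
def grad3 (f : E3 → ℝ) (x : E3) : E3 := mk3 fun i => pd3 f i x

/-- A measure-valued 2-form carried by the set `S ⊆ ℝ³` (identified with a vector-valued
measure via the Hodge star): a finite total-variation measure together with a unit
direction field. -/
structure MVF3 (S : Set E3) where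
  tv : Measure E3
  dir : E3 → E3
  finite : tv Set.univ < ⊤
  suppIn : tv Sᶜ = 0
  unit : ∀ᵐ x ∂tv, ‖dir x‖ = 1

def MVF3.pair {S : Set E3} (α : MVF3 S) (φ : E3 → E3) : ℝ :=
  ∫ x, dot3 (α.dir x) (φ x) ∂α.tv

def MVF3.mass {S : Set E3} (α : MVF3 S) : ℝ := (α.tv Set.univ).toReal

/-- The `W^{-1,1}(ℝ³)` norm of the (signed) measure `ζ = ζ⁺ − ζ⁻`:
`sup { ∫ φ dζ : φ ∈ W^{1,∞}_c(ℝ³), ‖φ‖_{W^{1,∞}} ≤ 1 }`. -/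
def wm11Norm (ζp ζm : Measure E3) : ℝ :=
  sSup {r : ℝ | ∃ f : E3 → ℝ, LipschitzWith 1 f ∧ (∀ x, |f x| ≤ 1) ∧
    HasCompactSupport f ∧ r = (∫ x, f x ∂ζp) - ∫ x, f x ∂ζm}

theorem aux_hb {E F : Type*} [AddCommGroup E] [Module ℝ E] [AddCommGroup F] [Module ℝ F]
    (T : F →ₗ[ℝ] E) (l : F →ₗ[ℝ] ℝ) (N : E → ℝ)
    (N_hom : ∀ c : ℝ, 0 < c → ∀ x, N (c • x) = c * N x) (N_add : ∀ x y, N (x + y) ≤ N x + N y)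
    (h : ∀ f, l f ≤ N (T f)) :
    ∃ Λ : E →ₗ[ℝ] ℝ, (∀ f, Λ (T f) = l f) ∧ ∀ x, Λ x ≤ N x := by
  have N0 : N 0 = 0 := by
    have := N_hom 2 (by norm_num) 0
    rw [smul_zero] at this
    linarith
  have hker : ∀ f, T f = 0 → l f = 0 := by
    intro f hf
    have h1 := h f
    have h2 := h (-f)
    simp [hf, N0] at h1 h2
    linarith
  obtain ⟨g, hg⟩ := LinearMap.exists_rightInverse_of_surjective T.rangeRestrict
    (LinearMap.range_rangeRestrict T)
  have hg' : ∀ y, T (g y) = y := by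
    intro y
    have := congrArg (fun k => ((k y : LinearMap.range T) : E)) hg
    simpa using this
  have hlg : ∀ f, l (g (T.rangeRestrict f)) = l f := by
    intro f
    have : l (g (T.rangeRestrict f) - f) = 0 := by
      apply hker
      rw [map_sub, hg']
      simp
    rw [map_sub] at this
    linarith
  obtain ⟨Λ, h1, h2⟩ := exists_extension_of_le_sublinear
    (⟨LinearMap.range T, l ∘ₗ g⟩ : E →ₗ.[ℝ] ℝ) N N_hom N_add (by
      rintro ⟨y, f, rfl⟩
      have := h f
      rw [← hlg f] at this
      exact this)
  exact ⟨Λ, fun f => (h1 (T.rangeRestrict f)).trans (hlg f), h2⟩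

open scoped CompactlySupported NNReal ENNReal in
theorem aux_riesz {X : Type*} [TopologicalSpace X] [T2Space X] [CompactSpace X] [Nonempty X]
    [MeasurableSpace X] [BorelSpace X] {F : Type*} [AddCommGroup F] [Module ℝ F]
    (T : F →ₗ[ℝ] C_c(X, ℝ)) (l : F →ₗ[ℝ] ℝ) (N : ℝ) (hN : 0 ≤ N)
    (h : ∀ f, l f ≤ N * ⨆ x, T f x) :
    ∃ μ : Measure X, IsFiniteMeasure μ ∧ (∀ f, ∫ x, T f x ∂μ = l f) ∧ μ.real univ ≤ N := by
  have hbdd : ∀ g : C_c(X, ℝ), BddAbove (range fun x => g x) := fun g =>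
    (isCompact_range g.continuous).bddAbove
  obtain ⟨Λ, hΛ1, hΛ2⟩ := aux_hb T l (fun u : C_c(X, ℝ) => N * ⨆ x, u x)
    (by
      intro c hc u
      simp only [CompactlySupportedContinuousMap.smul_apply, smul_eq_mul]
      rw [← Real.mul_iSup_of_nonneg hc.le]
      ring)
    (by
      intro u v
      rw [← mul_add]
      apply mul_le_mul_of_nonneg_left _ hN
      apply ciSup_le
      intro x
      simp only [CompactlySupportedContinuousMap.add_apply]
      exact add_le_add (le_ciSup (hbdd u) x) (le_ciSup (hbdd v) x))
    h
  have hpos : ∀ u : C_c(X, ℝ), 0 ≤ u → 0 ≤ Λ u := by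
    intro u hu
    have h1 := hΛ2 (-u)
    have h2 : (⨆ x, (-u) x) ≤ 0 := ciSup_le fun x => by
      have := hu x
      simpa using this
    have h3 := mul_nonpos_of_nonneg_of_nonpos hN h2
    rw [map_neg] at h1
    linarith
  let P : C_c(X, ℝ) →ₚ[ℝ] ℝ := PositiveLinearMap.mk₀ Λ hpos
  have hP : ∀ u, P u = Λ u := fun u => rfl
  refine ⟨RealRMK.rieszMeasure P, inferInstance, ?_, ?_⟩
  · intro f
    rw [RealRMK.integral_rieszMeasure, hP]
    exact hΛ1 f
  · let one : C_c(X, ℝ) := CompactlySupportedContinuousMap.continuousMapEquiv (1 : C(X, ℝ))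
    have h1 : ∀ x, one x = 1 := fun x => rfl
    have h2 := RealRMK.integral_rieszMeasure P one
    simp only [h1, integral_const, smul_eq_mul, mul_one] at h2
    rw [h2, hP]
    have := hΛ2 one
    simpa [h1] using this

theorem aux_dot (f : E3 → ℝ) (x v : E3) : dot3 v (grad3 f x) = fderiv ℝ f x v := by
  have hv : v = ∑ i, v i • e3 i := by
    ext j
    simp [e3, Finset.sum_apply, Pi.single_apply]
  conv_rhs => rw [hv]
  simp [dot3, grad3, mk3, pd3]

theorem aux_polar (K : Set E3) (hK : MeasurableSet K)
    (ρ : Measure (E3 × closedBall (0 : E3) 1)) [IsFiniteMeasure ρ]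
    (hρ : ρ (Prod.fst ⁻¹' Kᶜ) = 0) :
    ∃ α : MVF3 K, α.mass ≤ ρ.real univ ∧
      ∀ f : E3 → ℝ, ContDiff ℝ (⊤ : ℕ∞) f → HasCompactSupport f →
        α.pair (grad3 f) = ∫ p, fderiv ℝ f p.1 (p.2 : E3) ∂ρ := by
  let b : E3 → E3 := fun x => ∫ v, (v : E3) ∂(ρ.condKernel x)
  have hb : Measurable b := by
    apply StronglyMeasurable.measurable
    exact MeasureTheory.StronglyMeasurable.integral_kernel
      (measurable_subtype_coe.stronglyMeasurable)
  have hint : ∀ x, Integrable (fun v : closedBall (0 : E3) 1 => (v : E3)) (ρ.condKernel x) := by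
    intro x
    refine Integrable.of_bound measurable_subtype_coe.aestronglyMeasurable 1 ?_
    exact Filter.Eventually.of_forall fun v => mem_closedBall_zero_iff.1 v.2
  have hb1 : ∀ x, ‖b x‖ ≤ 1 := by
    intro x
    have := norm_integral_le_of_norm_le_const (μ := ρ.condKernel x)
      (f := fun v : closedBall (0 : E3) 1 => (v : E3)) (C := 1)
      (Filter.Eventually.of_forall fun v => mem_closedBall_zero_iff.1 v.2)
    simpa using this
  have hb1' : ∀ x, (‖b x‖₊ : ENNReal) ≤ 1 := by
    intro x
    exact_mod_cast hb1 x
  have hmass : (ρ.fst.withDensity fun x => (‖b x‖₊ : ENNReal)) univ ≤ ρ univ := by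
    rw [withDensity_apply _ MeasurableSet.univ, ← Measure.fst_univ]
    calc _ ≤ ∫⁻ x in univ, 1 ∂ρ.fst := lintegral_mono hb1'
      _ = _ := by simp
  have hbm : Measurable fun x => ‖b x‖₊ := hb.nnnorm
  refine ⟨⟨ρ.fst.withDensity fun x => (‖b x‖₊ : ENNReal), fun x => ‖b x‖⁻¹ • b x,
    hmass.trans_lt (measure_lt_top _ _), ?_, ?_⟩, ?_, ?_⟩
  · apply withDensity_absolutelyContinuous
    rw [Measure.fst_apply hK.compl]
    exact hρ
  · rw [ae_withDensity_iff hbm.coe_nnreal_ennreal]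
    refine Filter.Eventually.of_forall fun x hx => ?_
    have : ‖b x‖ ≠ 0 := by simpa using hx
    rw [norm_smul, norm_inv, norm_norm, inv_mul_cancel₀ this]
  · exact ENNReal.toReal_mono (measure_ne_top _ _) hmass
  · intro f hf hfc
    have hcont : Continuous (fderiv ℝ f) := hf.continuous_fderiv (by simp)
    obtain ⟨C, hC⟩ := hcont.bounded_above_of_compact_support (hfc.fderiv (𝕜 := ℝ))
    have hI : Integrable (fun p : E3 × closedBall (0 : E3) 1 => fderiv ℝ f p.1 (p.2 : E3)) ρ := by
      have hc : Continuous (fun p : E3 × closedBall (0 : E3) 1 => fderiv ℝ f p.1 (p.2 : E3)) :=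
        (hcont.comp continuous_fst).clm_apply (continuous_subtype_val.comp continuous_snd)
      refine Integrable.of_bound hc.aestronglyMeasurable C ?_
      refine Filter.Eventually.of_forall fun p => ?_
      have h1 := (fderiv ℝ f p.1).le_opNorm (p.2 : E3)
      have h2 : ‖(p.2 : E3)‖ ≤ 1 := mem_closedBall_zero_iff.1 p.2.2
      have h3 := hC p.1
      have h4 := norm_nonneg (fderiv ℝ f p.1)
      nlinarith
    rw [← Measure.integral_condKernel hI]
    simp only [MVF3.pair, aux_dot]
    rw [integral_withDensity_eq_integral_smul hbm]
    congr 1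
    ext x
    rw [ContinuousLinearMap.integral_comp_comm _ (hint x)]
    change ‖b x‖ • (fderiv ℝ f x) (‖b x‖⁻¹ • b x) = fderiv ℝ f x (b x)
    by_cases h0 : ‖b x‖ = 0
    · have : b x = 0 := by simpa using h0
      simp [this]
    · rw [map_smul, smul_smul, mul_inv_cancel₀ h0, one_smul]

theorem aux_norm_bdd (ζp ζm : Measure E3) [IsFiniteMeasure ζp] [IsFiniteMeasure ζm] :
    BddAbove {r : ℝ | ∃ f : E3 → ℝ, LipschitzWith 1 f ∧ (∀ x, |f x| ≤ 1) ∧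
    HasCompactSupport f ∧ r = (∫ x, f x ∂ζp) - ∫ x, f x ∂ζm} := by
  refine ⟨ζp.real univ + ζm.real univ, ?_⟩
  rintro r ⟨f, -, h1, -, rfl⟩
  have hp := norm_integral_le_of_norm_le_const (μ := ζp) (f := f) (C := 1)
    (Filter.Eventually.of_forall h1)
  have hm := norm_integral_le_of_norm_le_const (μ := ζm) (f := f) (C := 1)
    (Filter.Eventually.of_forall h1)
  rw [Real.norm_eq_abs, one_mul] at hp hm
  linarith [(abs_le.1 hp).2, (abs_le.1 hm).1]

theorem aux_norm_nonneg (ζp ζm : Measure E3) [IsFiniteMeasure ζp] [IsFiniteMeasure ζm] :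
    0 ≤ wm11Norm ζp ζm := by
  apply le_csSup (aux_norm_bdd ζp ζm)
  refine ⟨fun _ => 0, LipschitzWith.const' 0, by simp, HasCompactSupport.zero, by simp⟩

theorem aux_bound (K : Set E3) (x₀ : E3) (hx₀ : x₀ ∈ K) (R : ℝ) (hR : 0 < R)
    (hKR : ∀ x ∈ K, ‖x‖ ≤ R)
    (ζp ζm : Measure E3) [IsFiniteMeasure ζp] [IsFiniteMeasure ζm]
    (hp : ∀ᵐ x ∂ζp, x ∈ K) (hm : ∀ᵐ x ∂ζm, x ∈ K)
    (hpm : ζp univ = ζm univ) (f : E3 → ℝ) (hfc : Continuous f) (hfs : HasCompactSupport f)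
    (M : NNReal) (hf : LipschitzOnWith M f K) :
    (∫ x, f x ∂ζp) - ∫ x, f x ∂ζm ≤ (1 + 3 * R) * wm11Norm ζp ζm * M := by
  obtain ⟨h, hh, hfh⟩ := hf.extend_real
  let w : E3 → ℝ := fun x => M * max (3 * R - ‖x‖) 0
  have hw : LipschitzWith M w := by
    refine LipschitzWith.of_dist_le_mul fun x y => ?_
    simp only [w, Real.dist_eq]
    rw [← mul_sub, abs_mul, abs_of_nonneg M.coe_nonneg]
    apply mul_le_mul_of_nonneg_left _ M.2
    refine (abs_max_sub_max_le_abs _ _ _).trans ?_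
    have := abs_norm_sub_norm_le y x
    rw [dist_comm, dist_eq_norm,
      show 3 * R - ‖x‖ - (3 * R - ‖y‖) = ‖y‖ - ‖x‖ by ring]
    exact this
  have hw0 : ∀ x, 0 ≤ w x := fun x => mul_nonneg M.2 (le_max_right _ _)
  have hw1 : ∀ x, w x ≤ M * (3 * R) := fun x => mul_le_mul_of_nonneg_left
    (max_le (by linarith [norm_nonneg x]) (by linarith)) M.2
  have hwK : ∀ x ∈ K, M * (2 * R) ≤ w x := fun x hx => mul_le_mul_of_nonneg_left
    (le_max_of_le_left (by linarith [hKR x hx])) M.2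
  let g : E3 → ℝ := fun x => max (min (h x - f x₀) (w x)) (-w x)
  have hh' : LipschitzWith M (fun x => h x - f x₀) := by
    refine LipschitzWith.of_dist_le_mul fun x y => ?_
    simpa using hh.dist_le_mul x y
  have hg : LipschitzWith M g := by
    have := (hh'.min hw).max hw.neg
    simpa using this
  have hgw : ∀ x, |g x| ≤ w x := fun x => by
    rw [abs_le]
    exact ⟨le_max_right _ _, max_le (min_le_right _ _) (by linarith [hw0 x])⟩
  have hgK : ∀ x ∈ K, g x = f x - f x₀ := by
    intro x hx
    have h1 := hf.dist_le_mul x hx x₀ hx₀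
    have h2 : dist x x₀ ≤ 2 * R := by
      rw [dist_eq_norm]
      linarith [norm_sub_le x x₀, hKR x hx, hKR x₀ hx₀]
    have h3 : |f x - f x₀| ≤ w x := by
      rw [Real.dist_eq] at h1
      exact h1.trans ((mul_le_mul_of_nonneg_left h2 M.2).trans (hwK x hx))
    rw [abs_le] at h3
    simp only [g]
    rw [← hfh hx, min_eq_left h3.2, max_eq_left h3.1]
  have hgs : HasCompactSupport g := by
    refine HasCompactSupport.intro (isCompact_closedBall (0 : E3) (3 * R)) fun x hx => ?_
    have hx' : 3 * R < ‖x‖ := by simpa using hx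
    have : w x = 0 := by simp [w, max_eq_right (by linarith : 3 * R - ‖x‖ ≤ 0)]
    have h2 := hgw x
    rw [this] at h2
    exact abs_nonpos_iff.1 h2
  have hfi : ∀ μ : Measure E3, IsFiniteMeasure μ → Integrable f μ := fun μ _ =>
    hfc.integrable_of_hasCompactSupport hfs
  have key : ∀ μ : Measure E3, IsFiniteMeasure μ → (∀ᵐ x ∂μ, x ∈ K) →
      ∫ x, g x ∂μ = ∫ x, f x ∂μ - μ.real univ * f x₀ := by
    intro μ _ hμ
    rw [integral_congr_ae (g := fun x => f x - f x₀) (hμ.mono hgK),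
      integral_sub (hfi μ inferInstance) (integrable_const _)]
    simp
  have hreal : ζp.real univ = ζm.real univ := by simp [Measure.real, hpm]
  have heq : (∫ x, f x ∂ζp) - ∫ x, f x ∂ζm = (∫ x, g x ∂ζp) - ∫ x, g x ∂ζm := by
    rw [key ζp inferInstance hp, key ζm inferInstance hm, hreal]
    ring
  rw [heq]
  rcases eq_or_lt_of_le (show 0 ≤ M from bot_le) with h0 | hpos
  · have : ∀ x, g x = 0 := fun x => by
      have := (hgw x).trans (hw1 x)
      rw [← h0] at this
      exact abs_nonpos_iff.1 (by simpa using this)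
    simp [this, ← h0]
  · have hpos' : (0 : ℝ) < M := hpos
    let c : ℝ := (M * (1 + 3 * R))⁻¹
    have hcp : 0 < M * (1 + 3 * R) := by positivity
    have hc : 0 < c := inv_pos.2 hcp
    have hcM : c * M ≤ 1 := by
      rw [inv_mul_le_iff₀ hcp]
      nlinarith
    have hcM2 : c * (M * (3 * R)) ≤ 1 := by
      rw [inv_mul_le_iff₀ hcp]
      nlinarith
    have hle : c * ((∫ x, g x ∂ζp) - ∫ x, g x ∂ζm) ≤ wm11Norm ζp ζm := by
      apply le_csSup (aux_norm_bdd ζp ζm)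
      refine ⟨fun x => c * g x, ?_, ?_, ?_, ?_⟩
      · refine LipschitzWith.of_dist_le_mul fun x y => ?_
        have h1 := hg.dist_le_mul x y
        rw [Real.dist_eq] at h1 ⊢
        rw [← mul_sub, abs_mul, abs_of_pos hc]
        have h2 := mul_le_mul_of_nonneg_left h1 hc.le
        have h3 := mul_le_mul_of_nonneg_right hcM (dist_nonneg (x := x) (y := y))
        simp only [NNReal.coe_one]
        linarith
      · intro x
        rw [abs_mul, abs_of_pos hc]
        exact (mul_le_mul_of_nonneg_left ((hgw x).trans (hw1 x)) hc.le).trans hcM2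
      · exact hgs.mul_left (f := fun _ => c)
      · rw [integral_const_mul, integral_const_mul]
        ring
    rw [inv_mul_le_iff₀ hcp] at hle
    linarith

def auxF : Submodule ℝ (E3 → ℝ) where
  carrier := {f | ContDiff ℝ (⊤ : ℕ∞) f ∧ HasCompactSupport f}
  add_mem' := fun ha hb => ⟨ha.1.add hb.1, ha.2.add hb.2⟩
  zero_mem' := ⟨contDiff_const, HasCompactSupport.zero⟩
  smul_mem' := fun c _ hf => ⟨contDiff_const.smul hf.1, hf.2.smul_left (f := fun _ => c)⟩

theorem auxF_diff (f : auxF) : Differentiable ℝ (f : E3 → ℝ) := f.2.1.differentiable (by simp)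

theorem auxF_cont (f : auxF) : Continuous (fderiv ℝ (f : E3 → ℝ)) :=
  f.2.1.continuous_fderiv (by simp)

open scoped CompactlySupported in
def auxT (K : Set E3) [CompactSpace K] :
    auxF →ₗ[ℝ] C_c(K × closedBall (0 : E3) 1, ℝ) where
  toFun f := CompactlySupportedContinuousMap.continuousMapEquiv
    ⟨fun p => fderiv ℝ (f : E3 → ℝ) p.1 (p.2 : E3),
      ((auxF_cont f).comp (continuous_subtype_val.comp continuous_fst)).clm_apply
        (continuous_subtype_val.comp continuous_snd)⟩
  map_add' f g := by
    ext p
    change fderiv ℝ ((f : E3 → ℝ) + (g : E3 → ℝ)) p.1 (p.2 : E3) =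
      fderiv ℝ (f : E3 → ℝ) p.1 (p.2 : E3) + fderiv ℝ (g : E3 → ℝ) p.1 (p.2 : E3)
    rw [fderiv_add (auxF_diff f _) (auxF_diff g _)]
    rfl
  map_smul' c f := by
    ext p
    change fderiv ℝ (c • (f : E3 → ℝ)) p.1 (p.2 : E3) =
      c • fderiv ℝ (f : E3 → ℝ) p.1 (p.2 : E3)
    rw [fderiv_const_smul (auxF_diff f _)]
    rfl

theorem auxT_apply (K : Set E3) [CompactSpace K] (f : auxF) (p) :
    auxT K f p = fderiv ℝ (f : E3 → ℝ) p.1 (p.2 : E3) := rfl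

theorem auxF_int (f : auxF) (μ : Measure E3) [IsFiniteMeasure μ] : Integrable (f : E3 → ℝ) μ :=
  f.2.1.continuous.integrable_of_hasCompactSupport f.2.2

def auxL (ζp ζm : Measure E3) [IsFiniteMeasure ζp] [IsFiniteMeasure ζm] : auxF →ₗ[ℝ] ℝ where
  toFun f := (∫ x, (f : E3 → ℝ) x ∂ζp) - ∫ x, (f : E3 → ℝ) x ∂ζm
  map_add' f g := by
    simp only [Submodule.coe_add, Pi.add_apply]
    rw [integral_add (auxF_int f _) (auxF_int g _), integral_add (auxF_int f _) (auxF_int g _)]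
    ring
  map_smul' c f := by
    simp only [Submodule.coe_smul, Pi.smul_apply, smul_eq_mul, integral_const_mul, RingHom.id_apply]
    ring

/-- **Lemma (minimal connections; Lemma `lem:mincon` of
Baldo–Jerrard–Orlandi–Soner).**  Let `K ⊂ ℝ³` be a compact convex domain and `ζ` a
signed measure supported on `∂K` with `ζ(∂K) = 0` (written here as `ζ = ζ⁺ − ζ⁻` with
`ζ⁺, ζ⁻` finite measures on `∂K` of equal total mass).  Then there is a measure-valued
2-form `α` supported in `K`, with `dα = 0` in the interior of `K` and tangential part
`α_⊤ = ζ` on `∂K` (i.e. `∫ f dζ = ∫_K df ∧ α` for all smooth `f`), whose total mass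
satisfies `|α|(K) ≤ C‖ζ‖_{W^{-1,1}(ℝ³)}`, with `C` depending only on `K`. -/
theorem minimal_connection_mass_bound
    (K : Set E3) (hK : IsCompact K) (hKconv : Convex ℝ K)
    (hKint : (interior K).Nonempty) :
    ∃ C > (0:ℝ), ∀ ζp ζm : Measure E3,
      IsFiniteMeasure ζp → IsFiniteMeasure ζm →
      ζp (frontier K)ᶜ = 0 → ζm (frontier K)ᶜ = 0 →
      ζp Set.univ = ζm Set.univ →
      ∃ α : MVF3 K,
        -- `dα = 0` in the interior of `K`
        (∀ f : E3 → ℝ, ContDiff ℝ (⊤ : ℕ∞) f → HasCompactSupport f →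
          tsupport f ⊆ interior K → α.pair (grad3 f) = 0) ∧
        -- `α_⊤ = ζ` on `∂K`:  `∫ f dζ = ∫_K df ∧ α` for every smooth `f`
        (∀ f : E3 → ℝ, ContDiff ℝ (⊤ : ℕ∞) f → HasCompactSupport f →
          α.pair (grad3 f) = (∫ x, f x ∂ζp) - ∫ x, f x ∂ζm) ∧
        α.mass ≤ C * wm11Norm ζp ζm := by
  obtain ⟨x₀, hx₀⟩ := hKint.mono interior_subset
  obtain ⟨R, hR, hKR⟩ := hK.isBounded.exists_pos_norm_le
  refine ⟨1 + 3 * R, by positivity, ?_⟩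
  intro ζp ζm _ _ hp hm hpm
  have hfr : frontier K ⊆ K := hK.isClosed.frontier_subset
  have hpf : ∀ᵐ x ∂ζp, x ∈ frontier K := hp
  have hmf : ∀ᵐ x ∂ζm, x ∈ frontier K := hm
  have : CompactSpace K := isCompact_iff_compactSpace.1 hK
  have : CompactSpace (closedBall (0 : E3) 1) :=
    isCompact_iff_compactSpace.1 (isCompact_closedBall _ _)
  have : Nonempty K := ⟨⟨x₀, hx₀⟩⟩
  let z : closedBall (0 : E3) 1 := ⟨0, by simp⟩
  have : Nonempty (closedBall (0 : E3) 1) := ⟨z⟩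
  obtain ⟨μ, hμ, hμ1, hμ2⟩ := aux_riesz (auxT K) (auxL ζp ζm) ((1 + 3 * R) * wm11Norm ζp ζm)
    (mul_nonneg (by positivity) (aux_norm_nonneg _ _)) (by
      intro f
      have hbdd : BddAbove (range fun p => auxT K f p) :=
        (isCompact_range (auxT K f).continuous).bddAbove
      set M := ⨆ p, auxT K f p with hM
      have hle : ∀ x (hx : x ∈ K) v (hv : ‖v‖ ≤ 1), fderiv ℝ (f : E3 → ℝ) x v ≤ M :=
        fun x hx v hv => le_ciSup hbdd (⟨x, hx⟩, ⟨v, by simpa using hv⟩)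
      have hM0 : 0 ≤ M := by
        have := hle x₀ hx₀ 0 (by simp)
        simpa using this
      have hlip : LipschitzOnWith ⟨M, hM0⟩ (f : E3 → ℝ) K := by
        refine hKconv.lipschitzOnWith_of_nnnorm_fderiv_le (𝕜 := ℝ)
          (fun x _ => auxF_diff f x) fun x hx => ?_
        change ‖fderiv ℝ (f : E3 → ℝ) x‖ ≤ M
        refine ContinuousLinearMap.opNorm_le_of_unit_norm hM0 fun v hv => ?_
        rw [Real.norm_eq_abs, abs_le]
        have h1 := hle x hx v hv.le
        have h2 := hle x hx (-v) (by rw [norm_neg]; exact hv.le)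
        rw [map_neg] at h2
        exact ⟨by linarith, h1⟩
      exact aux_bound K x₀ hx₀ R hR hKR ζp ζm (hpf.mono fun x hx => hfr hx)
        (hmf.mono fun x hx => hfr hx) hpm f f.2.1.continuous f.2.2 _ hlip)
  let φ : K × closedBall (0 : E3) 1 → E3 × closedBall (0 : E3) 1 := fun p => (p.1, p.2)
  have hφ : Measurable φ := (measurable_subtype_coe.comp measurable_fst).prodMk measurable_snd
  have hKm : MeasurableSet K := hK.measurableSet
  obtain ⟨α, hα1, hα2⟩ := aux_polar K hKm (μ.map φ) (by
    rw [Measure.map_apply hφ (measurable_fst hKm.compl)]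
    convert measure_empty (μ := μ)
    ext p
    simp [φ])
  have hmain : ∀ f : E3 → ℝ, ContDiff ℝ (⊤ : ℕ∞) f → HasCompactSupport f →
          α.pair (grad3 f) = (∫ x, f x ∂ζp) - ∫ x, f x ∂ζm := by
    intro f hf hfc
    have h1 := hμ1 ⟨f, hf, hfc⟩
    have hc : Continuous (fun p : E3 × closedBall (0 : E3) 1 => fderiv ℝ f p.1 (p.2 : E3)) :=
        ((hf.continuous_fderiv (by simp)).comp continuous_fst).clm_apply
          (continuous_subtype_val.comp continuous_snd)
    rw [hα2 f hf hfc, integral_map hφ.aemeasurable hc.aestronglyMeasurable]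
    exact h1
  refine ⟨α, ?_, hmain, ?_⟩
  · intro f hf hfc hs
    have h0 : ∀ x ∈ frontier K, f x = 0 := fun x hx =>
      image_eq_zero_of_notMem_tsupport fun h => hx.2 (hs h)
    rw [hmain f hf hfc, integral_eq_zero_of_ae (hpf.mono h0), integral_eq_zero_of_ae (hmf.mono h0),
      sub_zero]
  · refine hα1.trans (le_trans (le_of_eq ?_) hμ2)
    rw [map_measureReal_apply hφ MeasurableSet.univ, preimage_univ]
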